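/- For all integers a ≥ 1 and n ≥ 2, the (2a)-th crank moment satisfies Σ_{λ ⊢ n} crank(λ)^{2a} = Σ_{k=1}^{a} Σ_{(i_1,…,i_k)} (2^k·(2a)!/(k!·(2i_1)!⋯(2i_k)!)) · Σ p(n_0)·σ_{2i_1−1}(n_1)⋯σ_{2i_k−1}(n_k), where the middle sum runs over all ordered k-tuples of positive integers (i_1,…,i_k) with i_1 + ⋯ + i_k = a, and the inner sum runs over all tuples (n_0, n_1, …, n_k) with n_0 ≥ 0, n_1, …, n_k ≥ 1 and n_0 + n_1 + ⋯ + n_k = n. -/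

import Mathlib

open Finset

/-- Divisor power sum `σ_k(n) = ∑_{d ∣ n} d^k`. -/
def sigmaPow (k n : ℕ) : ℕ := ∑ d ∈ n.divisors, d ^ k

/-- The number of partitions of `n` (with `p 0 = 1`). -/
def partitionCount (n : ℕ) : ℕ := Fintype.card (Nat.Partition n)

/-- The Andrews–Garvan crank of a partition: the largest part if there are no ones, and
otherwise the number of parts larger than the number of ones minus the number of ones. -/
def crank {n : ℕ} (lam : n.Partition) : ℤ :=
  if lam.parts.count 1 = 0 then (lam.parts.sup : ℤ)
  else ((lam.parts.filter (fun x => lam.parts.count 1 < x)).card : ℤ)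
    - (lam.parts.count 1 : ℤ)

open PowerSeries

section PartitionSeries

variable {R : Type*} [CommRing R]

/-- The coefficient of a product of power series in `X ^ i`, for `1 ≤ i ≤ N`, as a weighted count
of partitions by the multiplicities of their parts. -/
theorem sum_partition_prod_count (f : ℕ → ℕ → R) {n N : ℕ} (hnN : n ≤ N) :
    ∑ lam : n.Partition, ∏ i ∈ Icc 1 N, f i (lam.parts.count i) =
      coeff n (∏ i ∈ Icc 1 N, PowerSeries.mk fun m => if i ∣ m then f i (m / i) else 0) := by
  rw [coeff_prod]
  refine sum_of_injOn Nat.Partition.toFinsuppAntidiag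
    (Nat.Partition.toFinsuppAntidiag_injective n).injOn ?_ ?_ ?_
  · intro p _
    exact finsuppAntidiag_mono (Icc_subset_Icc_right hnN) _
      p.toFinsuppAntidiag_mem_finsuppAntidiag
  · intro g hg hg'
    obtain ⟨h1, h2⟩ := mem_finsuppAntidiag.mp hg
    suffices h : ∃ i ∈ Icc 1 N, ¬ i ∣ g i by
      obtain ⟨i, hi, hd⟩ := h
      exact prod_eq_zero hi (by simp [hd])
    by_contra! hdvd
    have hdvd' (i : ℕ) : i ∣ g i := by
      by_cases hi : i ∈ Icc 1 N
      · exact hdvd i hi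
      · have : g i = 0 := by
          by_contra h
          exact hi (h2 (by simpa using h))
        simp [this]
    have hpos (i : ℕ) (hi : g i ≠ 0) : 0 < i := by
      have := h2 (Finsupp.mem_support_iff.mpr hi)
      grind
    refine hg' ⟨⟨Finsupp.toMultiset (Finsupp.mk g.support (fun i => g i / i) ?_), ?_, ?_⟩, ?_, ?_⟩
    · intro i
      obtain ⟨c, hc⟩ := hdvd' i
      rcases Nat.eq_zero_or_pos i with rfl | hi
      · simp_all
      · simp [hc, hi.ne']
    · intro i hi
      simp only [Finsupp.mem_toMultiset, Finsupp.mem_support_iff] at hi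
      exact hpos i hi
    · refine Eq.trans ?_ h1
      rw [Finsupp.sum_toMultiset]
      exact (sum_congr rfl fun i _ => Nat.div_mul_cancel (hdvd' i)).trans
        (sum_subset h2 fun i _ hi => by simpa using hi)
    · simp
    · ext i
      simpa [Nat.Partition.toFinsuppAntidiag] using Nat.div_mul_cancel (hdvd' i)
  · intro p _
    refine prod_congr rfl fun i hi => ?_
    have : 0 < i := by grind
    simp [Nat.Partition.toFinsuppAntidiag, this]

/-- The geometric series `∑ j, w ^ j * X ^ (i * j)`. -/
def geomSeries (w : R) (i : ℕ) : R⟦X⟧ :=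
  PowerSeries.mk fun m => if i ∣ m then w ^ (m / i) else 0

theorem one_sub_mul_geomSeries (w : R) {i : ℕ} (hi : 0 < i) :
    (1 - C w * X ^ i) * geomSeries w i = 1 := by
  ext m
  rw [sub_mul, one_mul, map_sub, mul_assoc, coeff_C_mul, coeff_X_pow_mul', coeff_one]
  simp only [geomSeries, coeff_mk]
  rcases Nat.eq_zero_or_pos m with rfl | hm
  · simp [hi.ne']
  by_cases hd : i ∣ m
  · obtain ⟨c, rfl⟩ := hd
    obtain ⟨c, rfl⟩ : ∃ d, c = d + 1 := ⟨c - 1, by grind⟩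
    have : i * (c + 1) - i = i * c := by rw [mul_add, mul_one, Nat.add_sub_cancel]
    simp [hi, hi.ne', this, pow_succ']
  · by_cases him : i ≤ m
    · have : ¬ i ∣ m - i := fun h => hd (by
        simpa [Nat.sub_add_cancel him] using (Nat.dvd_add_self_right (m := i)).mpr h)
      simp [hd, hm.ne', this]
    · simp [hd, hm.ne', him]

theorem mk_ite_div_eq (k : ℕ) {i : ℕ} (hi : 0 < i) :
    (PowerSeries.mk fun c => if i ∣ c then (if c / i = k then 1 else 0) else 0) =
      (X ^ (i * k) : R⟦X⟧) := by
  ext c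
  rw [coeff_mk, coeff_X_pow]
  by_cases hd : i ∣ c
  · obtain ⟨d, rfl⟩ := hd
    simp [hi.ne']
  · have : c ≠ i * k := fun h => hd ⟨k, h⟩
    simp [hd, this]

theorem mk_ite_div_ne_zero {i : ℕ} (hi : 0 < i) :
    (PowerSeries.mk fun c => if i ∣ c then (if c / i = 0 then 0 else 1) else 0) =
      X ^ i * geomSeries (1 : R) i := by
  have h : X ^ i * geomSeries (1 : R) i = geomSeries 1 i - 1 := by
    have h := one_sub_mul_geomSeries (1 : R) hi
    rw [map_one] at h
    linear_combination -h
  have h0 := mk_ite_div_eq (R := R) 0 hi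
  rw [mul_zero, pow_zero] at h0
  rw [h, ← h0]
  ext c
  simp only [geomSeries, coeff_mk, map_sub]
  split_ifs <;> simp

/-- The generating function of the number of partitions. -/
theorem coeff_prod_geomSeries_one {n N : ℕ} (hnN : n ≤ N) :
    coeff n (∏ i ∈ Icc 1 N, geomSeries (1 : R) i) = partitionCount n := by
  simpa [geomSeries, partitionCount] using
    (sum_partition_prod_count (fun _ _ => (1 : R)) hnN).symm

/-- The generating function of partitions without ones whose largest part is `m`. -/
theorem card_partition_sup_eq {n N m : ℕ} (hnN : n ≤ N) (hm : 2 ≤ m) (hmN : m ≤ N) :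
    ∑ lam : n.Partition, (if lam.parts.count 1 = 0 ∧ lam.parts.sup = m then 1 else 0 : R) =
      coeff n (X ^ m * ∏ i ∈ Icc 2 m, geomSeries (1 : R) i) := by
  let f (i c : ℕ) : R :=
    if i = 1 ∨ m < i then (if c = 0 then 1 else 0) else
      if i = m then (if c = 0 then 0 else 1) else 1
  have hf : ∏ i ∈ Icc 1 N, (PowerSeries.mk fun c => if i ∣ c then f i (c / i) else 0) =
      X ^ m * ∏ i ∈ Icc 2 m, geomSeries (1 : R) i := by
    have (i : ℕ) (hi : i ∈ Icc 1 N) : (PowerSeries.mk fun c => if i ∣ c then f i (c / i) else 0) =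
        (if i = m then X ^ m else 1) * (if i ∈ Icc 2 m then geomSeries (1 : R) i else 1) := by
      obtain ⟨hi1, hiN⟩ := mem_Icc.mp hi
      by_cases h1 : i = 1 ∨ m < i
      · simp only [f, if_pos h1]
        rw [mk_ite_div_eq 0 hi1, if_neg (by grind), if_neg (by grind)]
        simp
      by_cases h2 : i = m
      · simp only [f, if_neg h1, if_pos h2]
        rw [mk_ite_div_ne_zero hi1, if_pos (by grind), h2]
      · simp only [f, if_neg h1, if_neg h2]
        rw [if_pos (by grind), one_mul]
        simp [geomSeries]
    rw [prod_congr rfl this, prod_mul_distrib, prod_ite_eq', prod_ite_mem,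
      inter_eq_right.mpr (Icc_subset_Icc (by simp) hmN), if_pos (by grind)]
  rw [← hf, ← sum_partition_prod_count f hnN]
  refine sum_congr rfl fun lam _ => ?_
  split_ifs with h
  · refine (prod_eq_one fun i hi => ?_).symm
    obtain ⟨h1, hsup⟩ := h
    have hle (p : ℕ) (hp : p ∈ lam.parts) : p ≤ m := hsup ▸ Multiset.le_sup hp
    by_cases hi1 : i = 1 ∨ m < i
    · have : lam.parts.count i = 0 := by
        rcases hi1 with rfl | hi1
        · exact h1
        · exact Multiset.count_eq_zero.mpr fun hp => absurd (hle i hp) (by omega)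
      simp [f, hi1, this]
    by_cases him : i = m
    · have : lam.parts.count i ≠ 0 := by
        rw [Multiset.count_ne_zero]
        by_contra hmem
        have : lam.parts.sup ≤ m - 1 := Multiset.sup_le.mpr fun p hp => by
          have := hle p hp
          have : p ≠ m := by rintro rfl; exact hmem (him ▸ hp)
          omega
        omega
      simp only [f, if_neg hi1, if_pos him, if_neg this]
    · simp [f, hi1, him]
  · symm
    by_cases h1 : lam.parts.count 1 = 0
    · by_cases hmem : m ∈ lam.parts
      · have hlt : m < lam.parts.sup :=
          lt_of_le_of_ne (Multiset.le_sup hmem) fun he => h ⟨h1, he.symm⟩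
        obtain ⟨p, hp, hmp⟩ : ∃ p ∈ lam.parts, m < p := by
          by_contra! hcon
          exact hlt.not_ge (Multiset.sup_le.mpr hcon)
        have hpN := (lam.le_of_mem_parts hp).trans hnN
        exact prod_eq_zero (i := p) (by grind) (by simp [f, hmp, hp])
      · refine prod_eq_zero (i := m) (by grind) ?_
        have : m ≠ 1 := by omega
        simp [f, this, hmem]
    · refine prod_eq_zero (i := 1) (by grind) ?_
      simp only [f, true_or, if_true, if_neg h1]

/-- The generating function of partitions with exactly `k` ones, weighted by the number of parts
larger than `k`. -/
theorem sum_partition_count_one_eq (z : R) {n N k : ℕ} (hnN : n ≤ N) (hk : 1 ≤ k) (hkN : k ≤ N) :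
    ∑ lam : n.Partition, (if lam.parts.count 1 = k then
        z ^ (lam.parts.filter (fun x => k < x)).card else 0) =
      coeff n (X ^ k * (∏ i ∈ Icc 2 k, geomSeries (1 : R) i) *
        ∏ i ∈ Icc (k + 1) N, geomSeries z i) := by
  let f (i c : ℕ) : R :=
    if i = 1 then (if c = k then 1 else 0) else if i ≤ k then 1 else z ^ c
  have hf : ∏ i ∈ Icc 1 N, (PowerSeries.mk fun c => if i ∣ c then f i (c / i) else 0) =
      X ^ k * (∏ i ∈ Icc 2 k, geomSeries (1 : R) i) * ∏ i ∈ Icc (k + 1) N, geomSeries z i := by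
    have (i : ℕ) (hi : i ∈ Icc 1 N) : (PowerSeries.mk fun c => if i ∣ c then f i (c / i) else 0) =
        (if i = 1 then X ^ k else 1) * (if i ∈ Icc 2 k then geomSeries (1 : R) i else 1) *
          (if i ∈ Icc (k + 1) N then geomSeries z i else 1) := by
      obtain ⟨hi1, hiN⟩ := mem_Icc.mp hi
      by_cases h1 : i = 1
      · simp only [f, if_pos h1]
        rw [mk_ite_div_eq k hi1, if_neg (by grind), if_neg (by grind), h1]
        simp
      by_cases h2 : i ≤ k
      · simp only [f, if_neg h1, if_pos h2]
        rw [if_pos (by grind), if_neg (by grind), one_mul, mul_one]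
        simp [geomSeries]
      · simp only [f, if_neg h1, if_neg h2]
        rw [if_neg (by grind), if_pos (by grind), one_mul, one_mul]
        rfl
    rw [prod_congr rfl this, prod_mul_distrib, prod_mul_distrib, prod_ite_eq', prod_ite_mem,
      prod_ite_mem, inter_eq_right.mpr (Icc_subset_Icc (by simp) hkN),
      inter_eq_right.mpr (Icc_subset_Icc (by simp) le_rfl), if_pos (by grind)]
  rw [← hf, ← sum_partition_prod_count f hnN]
  refine sum_congr rfl fun lam _ => ?_
  split_ifs with h
  · have (i : ℕ) (hi : i ∈ Icc 1 N) : f i (lam.parts.count i) =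
        if i ∈ Icc (k + 1) N then z ^ lam.parts.count i else 1 := by
      grind
    rw [prod_congr rfl this, prod_ite_mem, inter_eq_right.mpr (Icc_subset_Icc (by simp) le_rfl),
      prod_pow_eq_pow_sum, ← Multiset.sum_count_eq_card (s := Icc (k + 1) N)]
    · congr 1
      exact sum_congr rfl fun i hi => Multiset.count_filter_of_pos (by grind)
    · intro p hp
      obtain ⟨hp, hkp⟩ := Multiset.mem_filter.mp hp
      have := (lam.le_of_mem_parts hp).trans hnN
      grind
  · refine (prod_eq_zero (i := 1) (by grind) ?_).symm
    simp [f, h]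

/-- The generating function of the crank. -/
theorem sum_zpow_crank (z : Rˣ) {n N : ℕ} (hn : 2 ≤ n) (hnN : n ≤ N) :
    ∑ lam : n.Partition, ((z ^ crank lam : Rˣ) : R) =
      coeff n (∑ m ∈ Icc 2 N, C (z : R) ^ m * (X ^ m * ∏ i ∈ Icc 2 m, geomSeries (1 : R) i) +
        ∑ k ∈ Icc 1 N, C ((z⁻¹ : Rˣ) : R) ^ k * (X ^ k * (∏ i ∈ Icc 2 k, geomSeries (1 : R) i) *
          ∏ i ∈ Icc (k + 1) N, geomSeries (z : R) i)) := by
  rw [map_add, map_sum, map_sum]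
  simp_rw [← map_pow, coeff_C_mul]
  rw [sum_congr rfl fun m hm => congrArg _
      (card_partition_sup_eq (R := R) hnN (by grind) (by grind : m ≤ N)).symm,
    sum_congr rfl fun k hk => congrArg _
      (sum_partition_count_one_eq (z : R) hnN (by grind) (by grind : k ≤ N)).symm]
  simp_rw [mul_sum]
  rw [sum_comm, sum_comm (s := Icc 1 N), ← sum_add_distrib]
  refine sum_congr rfl fun lam _ => ?_
  by_cases h1 : lam.parts.count 1 = 0
  · have hsupN : lam.parts.sup ≤ N :=
      Multiset.sup_le.mpr fun p hp => (lam.le_of_mem_parts hp).trans hnN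
    have hsup2 : 2 ≤ lam.parts.sup := by
      obtain ⟨p, hp⟩ : ∃ p, p ∈ lam.parts := by
        by_contra! hcon
        have := lam.parts_sum
        rw [Multiset.eq_zero_of_forall_notMem hcon] at this
        simp at this
        omega
      have hp0 := lam.parts_pos hp
      have hp1 : p ≠ 1 := by
        rintro rfl
        exact Multiset.count_ne_zero.mpr hp h1
      exact le_trans (by omega) (Multiset.le_sup hp)
    rw [sum_eq_single lam.parts.sup, sum_eq_zero]
    · simp [crank, h1]
    · intro k hk
      rw [if_neg (by grind), mul_zero]
    · intro m _ hm
      rw [if_neg (by grind), mul_zero]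
    · intro h
      grind
  · have hN : lam.parts.count 1 ≤ N := by
      have h := Multiset.card_nsmul_le_sum (s := lam.parts) (a := 1) fun p hp => lam.parts_pos hp
      have := Multiset.count_le_card 1 lam.parts
      rw [lam.parts_sum] at h
      simp at h
      omega
    rw [sum_eq_zero, sum_eq_single (lam.parts.count 1)]
    · rw [if_pos rfl, crank, if_neg h1, zpow_sub, zero_add]
      simp [mul_comm]
    · intro k _ hk
      rw [if_neg (by grind), mul_zero]
    · intro h
      grind
    · intro m _
      rw [if_neg (by grind), mul_zero]

end PartitionSeries
section QSeries

variable {R : Type*} [CommRing R]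

/-- The `q`-Pochhammer symbol `∏ i < k, (1 - c q ^ i)` with `q = X`. -/
noncomputable def qPoch (c : R⟦X⟧) (k : ℕ) : R⟦X⟧ := ∏ i ∈ range k, (1 - c * X ^ i)

theorem qPoch_succ (c : R⟦X⟧) (k : ℕ) : qPoch c (k + 1) = qPoch c k * (1 - c * X ^ k) :=
  prod_range_succ _ _

/-- The generating function of partitions into parts of size at most `k`. -/
noncomputable def partSeries (k : ℕ) : R⟦X⟧ := ∏ i ∈ Icc 1 k, geomSeries (1 : R) i

theorem one_sub_mul_partSeries_succ (k : ℕ) :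
    (1 - X ^ (k + 1)) * partSeries (R := R) (k + 1) = partSeries k := by
  have h := one_sub_mul_geomSeries (1 : R) (by omega : 0 < k + 1)
  rw [map_one, one_mul] at h
  rw [partSeries, partSeries, prod_Icc_succ_top (by omega)]
  linear_combination (∏ i ∈ Icc 1 k, geomSeries (1 : R) i) * h

/-- The finite `q`-Chu–Vandermonde identity, with the `q`-binomial coefficients divided by the
`q`-factorial of `N`. -/
theorem sum_antidiagonal_qPoch (a b : R⟦X⟧) (N : ℕ) :
    ∑ p ∈ antidiagonal N, partSeries p.1 * partSeries p.2 * b ^ p.1 * qPoch a p.1 * qPoch b p.2 =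
      partSeries N * qPoch (a * b) N := by
  induction N with
  | zero => simp [partSeries, qPoch]
  | succ N ih =>
    have hreg : IsUnit (1 - X ^ (N + 1) : R⟦X⟧) := by
      have h := one_sub_mul_geomSeries (1 : R) (by omega : 0 < N + 1)
      rw [map_one, one_mul] at h
      exact IsUnit.of_mul_eq_one _ h
    refine hreg.mul_left_cancel ?_
    rw [← mul_assoc, one_sub_mul_partSeries_succ, qPoch_succ, ← mul_assoc, ← ih, mul_sum, sum_mul]
    let F (i j : ℕ) : R⟦X⟧ := partSeries i * partSeries j * b ^ i * qPoch a i * qPoch b j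
    calc ∑ p ∈ antidiagonal (N + 1), (1 - X ^ (N + 1)) * F p.1 p.2
        = ∑ p ∈ antidiagonal (N + 1), (1 - X ^ p.2) * F p.1 p.2 +
          ∑ p ∈ antidiagonal (N + 1), X ^ p.2 * (1 - X ^ p.1) * F p.1 p.2 := by
          rw [← sum_add_distrib]
          refine sum_congr rfl fun p hp => ?_
          rw [← mem_antidiagonal.mp hp, pow_add]
          ring
      _ = ∑ p ∈ antidiagonal N, (1 - X ^ (p.2 + 1)) * F p.1 (p.2 + 1) +
          ∑ p ∈ antidiagonal N, X ^ p.2 * (1 - X ^ (p.1 + 1)) * F (p.1 + 1) p.2 := by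
          rw [Nat.sum_antidiagonal_succ', Nat.sum_antidiagonal_succ]
          simp
      _ = _ := by
          rw [← sum_add_distrib]
          refine sum_congr rfl fun p hp => ?_
          have h1 := one_sub_mul_partSeries_succ (R := R) p.1
          have h2 := one_sub_mul_partSeries_succ (R := R) p.2
          rw [← mem_antidiagonal.mp hp]
          simp only [F, qPoch_succ, pow_succ b]
          linear_combination (partSeries p.1 * b ^ p.1 * qPoch a p.1 * qPoch b p.2 *
            (1 - b * X ^ p.2)) * h2 + (X ^ p.2 * partSeries p.2 * b ^ p.1 * b * qPoch a p.1 *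
            (1 - a * X ^ p.1) * qPoch b p.2) * h1

theorem dvd_prod_sub_one {ι : Type*} {x : R⟦X⟧} {s : Finset ι} {f : ι → R⟦X⟧}
    (h : ∀ i ∈ s, x ∣ f i - 1) : x ∣ ∏ i ∈ s, f i - 1 := by
  classical
  induction s using Finset.induction_on with
  | empty => simp
  | insert i s hi ih =>
    rw [prod_insert hi]
    have h1 := (h i (mem_insert_self _ _)).mul_right (∏ j ∈ s, f j)
    have h2 := ih fun j hj => h j (mem_insert_of_mem hj)
    convert dvd_add h1 h2 using 1
    ring

theorem X_pow_dvd_geomSeries_sub_one (w : R) {i : ℕ} (hi : 0 < i) :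
    X ^ i ∣ geomSeries w i - 1 :=
  ⟨C w * geomSeries w i, by linear_combination one_sub_mul_geomSeries w hi⟩

theorem qPoch_mul_prod_geomSeries (w : R) {k N : ℕ} (hk : k ≤ N) :
    qPoch (C w * X) k * ∏ i ∈ Icc 1 N, geomSeries w i = ∏ i ∈ Icc (k + 1) N, geomSeries w i := by
  induction k with
  | zero => simp [qPoch]
  | succ k ih =>
    have h := one_sub_mul_geomSeries w (by omega : 0 < k + 1)
    rw [← insert_Icc_add_one_left_eq_Icc (by omega : k + 1 ≤ N), prod_insert (by simp)] at ih
    rw [qPoch_succ, mul_right_comm, ih (by omega)]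
    rw [pow_succ] at h
    linear_combination (∏ i ∈ Icc (k + 1 + 1) N, geomSeries w i) * h

/-- The truncated two-variable generating function `(q)_∞ / ((zq)_∞ (uq)_∞)`. -/
noncomputable def crankSeries (z u : R) (N : ℕ) : R⟦X⟧ :=
  (∏ i ∈ Icc 1 (N + 1), (1 - X ^ i)) * (∏ i ∈ Icc 1 N, geomSeries z i) *
    ∏ i ∈ Icc 1 N, geomSeries u i

theorem qPoch_X (k : ℕ) : qPoch (X : R⟦X⟧) k = ∏ i ∈ Icc 1 k, (1 - X ^ i) := by
  induction k with
  | zero => simp [qPoch]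
  | succ k ih => rw [qPoch_succ, ih, prod_Icc_succ_top (by omega), pow_succ']

theorem one_sub_mul_qPoch_X_sq (k : ℕ) :
    (1 - X) * qPoch (X ^ 2 : R⟦X⟧) k = ∏ i ∈ Icc 1 (k + 1), (1 - X ^ i) := by
  rw [← qPoch_X, qPoch, qPoch, prod_range_succ', mul_comm]
  simp only [pow_zero, mul_one]
  congr 1
  exact prod_congr rfl fun i _ => by ring

theorem one_sub_mul_partSeries {k : ℕ} (hk : 1 ≤ k) :
    (1 - X) * partSeries (R := R) k = ∏ i ∈ Icc 2 k, geomSeries (1 : R) i := by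
  have h := one_sub_mul_geomSeries (1 : R) one_pos
  rw [map_one, one_mul, pow_one] at h
  rw [partSeries, ← insert_Icc_add_one_left_eq_Icc hk, prod_insert (by simp)]
  linear_combination (∏ i ∈ Icc 2 k, geomSeries (1 : R) i) * h

theorem qPoch_X_mul_partSeries (k : ℕ) : qPoch X k * partSeries k = (1 : R⟦X⟧) := by
  simpa [partSeries] using qPoch_mul_prod_geomSeries (1 : R) (le_refl k)

theorem X_pow_dvd_sum_antidiagonal (w : R) (N : ℕ) (c : ℕ → R⟦X⟧) :
    X ^ (N + 1) ∣ qPoch X N * (∏ i ∈ Icc 1 N, geomSeries w i) *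
      ∑ p ∈ antidiagonal N, c p.1 * X ^ p.1 * partSeries p.2 * qPoch (C w * X) p.2 -
        ∑ k ∈ range (N + 1), c k * X ^ k := by
  rw [← Nat.sum_antidiagonal_eq_sum_range_succ (fun i _ => c i * X ^ i), mul_sum,
    ← sum_sub_distrib]
  refine dvd_sum fun p hp => ?_
  have hN := mem_antidiagonal.mp hp
  have h1 := qPoch_mul_prod_geomSeries w (by omega : p.2 ≤ N)
  have h2 := qPoch_mul_prod_geomSeries (1 : R) (by omega : p.2 ≤ N)
  rw [map_one, one_mul] at h2
  have hdvd (v : R) : X ^ (p.2 + 1) ∣ ∏ i ∈ Icc (p.2 + 1) N, geomSeries v i - 1 :=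
    dvd_prod_sub_one fun i hi => (pow_dvd_pow _ (mem_Icc.mp hi).1).trans
      (X_pow_dvd_geomSeries_sub_one v (by grind))
  have h3 := qPoch_X_mul_partSeries (R := R) p.2
  have h4 := qPoch_X_mul_partSeries (R := R) N
  have h5 : X ^ (p.2 + 1) ∣ qPoch X N * partSeries p.2 - (1 : R⟦X⟧) := by
    refine ((hdvd 1).mul_left (-(qPoch X N * partSeries p.2))).trans (dvd_of_eq ?_)
    rw [← h2]
    change _ * (qPoch X p.2 * partSeries N - 1) = _
    linear_combination -(qPoch X N * partSeries N) * h3 - h4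
  rw [← hN, add_assoc, pow_add]
  refine (mul_dvd_mul_left (X ^ p.1)
    (dvd_add (h5.mul_right (∏ i ∈ Icc (p.2 + 1) N, geomSeries w i)) (hdvd w))).trans ?_
  refine Dvd.intro_left (c p.1) ?_
  rw [hN]
  linear_combination -(c p.1 * X ^ p.1 * qPoch X N * partSeries p.2) * h1

/-- The generating function of the crank, in product form. -/
theorem sum_zpow_crank_eq_coeff_crankSeries (z : Rˣ) {n N : ℕ} (hn : 2 ≤ n) (hnN : n ≤ N) :
    ∑ lam : n.Partition, ((z ^ crank lam : Rˣ) : R) =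
      coeff n (crankSeries (z : R) ((z⁻¹ : Rˣ) : R) N) := by
  set u : R := ((z⁻¹ : Rˣ) : R)
  rw [sum_zpow_crank z hn hnN]
  have hzu : C (z : R) * X * (C u * X) = X ^ 2 := by
    have : C (z : R) * C u = 1 := by rw [← map_mul, Units.mul_inv, map_one]
    linear_combination X ^ 2 * this
  set Hz := ∏ i ∈ Icc 1 N, geomSeries (z : R) i with hHz
  have hN := qPoch_X_mul_partSeries (R := R) N
  have hzero (k : ℕ) : qPoch (0 : R⟦X⟧) k = 1 := by simp [qPoch]
  have h1 : X ^ (N + 1) ∣ crankSeries (z : R) u N -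
      ∑ k ∈ range (N + 1), (1 - X) * partSeries k * C u ^ k *
        (∏ i ∈ Icc (k + 1) N, geomSeries (z : R) i) * X ^ k := by
    convert X_pow_dvd_sum_antidiagonal u N (fun k => (1 - X) * partSeries k * C u ^ k *
      (∏ i ∈ Icc (k + 1) N, geomSeries (z : R) i)) using 2
    have hV := sum_antidiagonal_qPoch (C (z : R) * X) (C u * X) N
    rw [hzu] at hV
    have hsum : ∑ p ∈ antidiagonal N, (1 - X) * partSeries p.1 * C u ^ p.1 *
        (∏ i ∈ Icc (p.1 + 1) N, geomSeries (z : R) i) * X ^ p.1 * partSeries p.2 *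
          qPoch (C u * X) p.2 = (1 - X) * Hz * (partSeries N * qPoch (X ^ 2) N) := by
      rw [← hV, mul_sum]
      refine sum_congr rfl fun p hp => ?_
      rw [← qPoch_mul_prod_geomSeries (z : R) (by have := mem_antidiagonal.mp hp; omega : p.1 ≤ N)]
      ring
    rw [hsum, crankSeries, ← one_sub_mul_qPoch_X_sq]
    linear_combination -((1 - X) * qPoch (X ^ 2) N * Hz * ∏ i ∈ Icc 1 N, geomSeries u i) * hN
  have h2 : X ^ (N + 1) ∣ Hz - ∑ k ∈ range (N + 1), partSeries k * C (z : R) ^ k * X ^ k := by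
    convert X_pow_dvd_sum_antidiagonal (z : R) N (fun k => partSeries k * C (z : R) ^ k) using 2
    have hV := sum_antidiagonal_qPoch 0 (C (z : R) * X) N
    rw [zero_mul, hzero, mul_one] at hV
    have hsum : ∑ p ∈ antidiagonal N, partSeries p.1 * C (z : R) ^ p.1 * X ^ p.1 *
        partSeries p.2 * qPoch (C (z : R) * X) p.2 = partSeries N := by
      rw [← hV]
      refine sum_congr rfl fun p hp => ?_
      rw [hzero]
      ring
    rw [hsum]
    linear_combination -Hz * hN
  rw [Nat.range_succ_eq_Icc_zero, ← insert_Icc_add_one_left_eq_Icc (by omega : 0 ≤ N),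
    sum_insert (by simp)] at h1 h2
  rw [← insert_Icc_add_one_left_eq_Icc (by omega : 0 + 1 ≤ N), sum_insert (by simp)] at h2
  have h3 := dvd_add h1 (h2.mul_left (1 - X))
  have hc := X_pow_dvd_iff.mp h3 n (by omega)
  set T := ∑ m ∈ Icc 2 N, C (z : R) ^ m * (X ^ m * ∏ i ∈ Icc 2 m, geomSeries (1 : R) i) with hT
  set U := ∑ k ∈ Icc 1 N, C u ^ k * (X ^ k * (∏ i ∈ Icc 2 k, geomSeries (1 : R) i) *
    ∏ i ∈ Icc (k + 1) N, geomSeries (z : R) i) with hU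
  have hT' : T = (1 - X) * ∑ k ∈ Icc (0 + 1 + 1) N, partSeries k * C (z : R) ^ k * X ^ k := by
    rw [hT, mul_sum]
    refine sum_congr rfl fun m hm => ?_
    rw [← one_sub_mul_partSeries (by grind)]
    ring
  have hU' : U = ∑ k ∈ Icc (0 + 1) N, (1 - X) * partSeries k * C u ^ k *
      (∏ i ∈ Icc (k + 1) N, geomSeries (z : R) i) * X ^ k := by
    refine sum_congr rfl fun k hk => ?_
    rw [← one_sub_mul_partSeries (by grind)]
    ring
  have hone : (1 - X) * partSeries (R := R) 1 = 1 := by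
    simpa using one_sub_mul_partSeries (R := R) le_rfl
  have hzero' : partSeries (R := R) 0 = 1 := by simp [partSeries]
  have hlin : coeff n ((1 - X : R⟦X⟧) + C (z : R) * X) = 0 := by
    simp [coeff_one, coeff_X, show n ≠ 0 by omega, show n ≠ 1 by omega]
  rw [eq_comm, ← sub_eq_zero, ← map_sub, ← hc, ← sub_eq_zero, ← map_sub, ← hlin]
  congr 1
  rw [hT', hU', hzero', zero_add, ← hHz]
  linear_combination (C (z : R) * X) * hone

theorem coeff_C_mul_X_pow_mul_geomSeries (w : R) {i : ℕ} (hi : 0 < i) (n : ℕ) :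
    coeff n (C w * X ^ i * geomSeries w i) = if i ∣ n ∧ n ≠ 0 then w ^ (n / i) else 0 := by
  have : C w * X ^ i * geomSeries w i = geomSeries w i - 1 := by
    linear_combination -one_sub_mul_geomSeries w hi
  rw [this, map_sub, coeff_one, geomSeries, coeff_mk]
  rcases Nat.eq_zero_or_pos n with rfl | hn
  · simp
  · simp [hn.ne']

theorem coeff_sum_C_mul_X_pow_mul_geomSeries (w : R) {n N : ℕ} (hnN : n ≤ N) :
    coeff n (∑ i ∈ Icc 1 N, C w * X ^ i * geomSeries w i) = ∑ m ∈ n.divisors, w ^ m := by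
  rw [map_sum, sum_congr rfl fun i hi =>
    coeff_C_mul_X_pow_mul_geomSeries w (mem_Icc.mp hi).1 n, ← sum_filter,
    ← Nat.sum_div_divisors n fun m => w ^ m]
  refine sum_congr ?_ fun _ _ => rfl
  ext i
  simp only [mem_filter, mem_Icc, Nat.mem_divisors]
  refine ⟨fun h => h.2, fun h => ⟨⟨Nat.pos_of_dvd_of_pos h.1 (by omega), ?_⟩, h⟩⟩
  exact (Nat.le_of_dvd (by omega) h.1).trans hnN

end QSeries
section LogDerivative

variable {R : Type*} [CommRing R] [Algebra ℚ R]

/-- The derivation of `R⟦X⟧` acting on the coefficients by a derivation of `R`. -/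
noncomputable def coeffDerivation (d : Derivation ℚ R R) : Derivation ℚ R⟦X⟧ R⟦X⟧ :=
  Derivation.mk'
    { toFun := fun F => PowerSeries.mk fun n => d (coeff n F)
      map_add' := fun F G => by ext; simp
      map_smul' := fun c F => by ext; simp }
    (fun F G => by
      ext n
      simp only [LinearMap.coe_mk, AddHom.coe_mk, coeff_mk, coeff_mul, smul_eq_mul, map_add,
        map_sum, Derivation.leibniz, sum_add_distrib]
      congr 1
      rw [← Nat.sum_antidiagonal_swap]
      rfl)

@[simp]
theorem coeff_coeffDerivation (d : Derivation ℚ R R) (F : R⟦X⟧) (n : ℕ) :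
    coeff n (coeffDerivation d F) = d (coeff n F) := by
  simp [coeffDerivation]

theorem coeffDerivation_C (d : Derivation ℚ R R) (r : R) :
    coeffDerivation d (C r) = C (d r) := by
  ext n
  simp only [coeff_coeffDerivation, coeff_C]
  split_ifs <;> simp

theorem coeffDerivation_X_pow (d : Derivation ℚ R R) (i : ℕ) :
    coeffDerivation d (X ^ i : R⟦X⟧) = 0 := by
  ext n
  simp only [coeff_coeffDerivation, coeff_X_pow]
  split_ifs <;> simp

theorem coeffDerivation_geomSeries (d : Derivation ℚ R R) {w ε : R} (hw : d w = ε * w) {i : ℕ}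
    (hi : 0 < i) : coeffDerivation d (geomSeries w i) =
      geomSeries w i * (C ε * (C w * X ^ i * geomSeries w i)) := by
  have h := one_sub_mul_geomSeries w hi
  have hD := congrArg (coeffDerivation d) h
  simp only [Derivation.leibniz, map_sub, Derivation.map_one_eq_zero, coeffDerivation_C,
    coeffDerivation_X_pow, hw, map_mul, smul_eq_mul] at hD
  linear_combination geomSeries w i * hD - coeffDerivation d (geomSeries w i) * h

theorem derivation_prod_eq {A ι : Type*} [CommRing A] [Algebra ℚ A] (D : Derivation ℚ A A)
    {f g : ι → A} {s : Finset ι} (h : ∀ i ∈ s, D (f i) = f i * g i) :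
    D (∏ i ∈ s, f i) = (∏ i ∈ s, f i) * ∑ i ∈ s, g i := by
  classical
  induction s using Finset.induction_on with
  | empty => simp
  | insert i s hi ih =>
    rw [prod_insert hi, sum_insert hi, Derivation.leibniz, h i (mem_insert_self _ _),
      ih fun j hj => h j (mem_insert_of_mem hj)]
    simp only [smul_eq_mul]
    ring

/-- The logarithmic derivative of `crankSeries`. -/
theorem coeffDerivation_crankSeries (d : Derivation ℚ R R) {z u : R} (hz : d z = z)
    (hu : d u = -u) (N : ℕ) :
    coeffDerivation d (crankSeries z u N) = crankSeries z u N *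
      ∑ i ∈ Icc 1 N, (C z * X ^ i * geomSeries z i - C u * X ^ i * geomSeries u i) := by
  have h1 : coeffDerivation d (∏ i ∈ Icc 1 (N + 1), (1 - X ^ i : R⟦X⟧)) = 0 := by
    rw [derivation_prod_eq _ (g := fun _ => 0) fun i _ => by
      rw [map_sub, coeffDerivation_X_pow]; simp]
    simp
  have h2 := derivation_prod_eq (coeffDerivation d) (s := Icc 1 N) fun i hi =>
    coeffDerivation_geomSeries d (w := z) (ε := 1) (by rw [hz, one_mul]) (mem_Icc.mp hi).1
  have h3 := derivation_prod_eq (coeffDerivation d) (s := Icc 1 N) fun i hi =>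
    coeffDerivation_geomSeries d (w := u) (ε := -1) (by rw [hu, neg_one_mul]) (mem_Icc.mp hi).1
  rw [crankSeries, Derivation.leibniz, Derivation.leibniz, h1, h2, h3, sum_sub_distrib]
  simp only [map_one, map_neg, ← mul_sum, smul_eq_mul]
  ring

end LogDerivative

section Moments

/-- The exponential series as a unit. -/
noncomputable def expUnit : ℚ⟦X⟧ˣ where
  val := exp ℚ
  inv := evalNegHom (exp ℚ)
  val_inv := exp_mul_exp_neg_eq_one
  inv_val := by rw [mul_comm, exp_mul_exp_neg_eq_one]

theorem coeff_expUnit_zpow (c : ℤ) (j : ℕ) :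
    coeff j ((expUnit ^ c : ℚ⟦X⟧ˣ) : ℚ⟦X⟧) = (c : ℚ) ^ j / j.factorial := by
  obtain ⟨m, rfl | rfl⟩ := c.eq_nat_or_neg
  · rw [zpow_natCast, Units.val_pow_eq_pow_val]
    change coeff j (exp ℚ ^ m) = _
    rw [exp_pow_eq_rescale_exp, coeff_rescale, coeff_exp]
    simp [div_eq_mul_inv]
  · rw [zpow_neg, zpow_natCast, ← inv_pow, Units.val_pow_eq_pow_val]
    change coeff j (evalNegHom (exp ℚ) ^ m) = _
    rw [← map_pow, exp_pow_eq_rescale_exp, evalNegHom, coeff_rescale, coeff_rescale, coeff_exp]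
    rw [← mul_assoc, ← mul_pow]
    simp [div_eq_mul_inv]

theorem coeff_expUnit_inv_pow (m j : ℕ) :
    coeff j (((expUnit⁻¹ : ℚ⟦X⟧ˣ) : ℚ⟦X⟧) ^ m) = (-m : ℚ) ^ j / j.factorial := by
  rw [← Units.val_pow_eq_pow_val, inv_pow, ← zpow_natCast, ← zpow_neg, coeff_expUnit_zpow]
  simp

theorem coeff_expUnit_pow (m j : ℕ) :
    coeff j ((expUnit : ℚ⟦X⟧) ^ m) = (m : ℚ) ^ j / j.factorial := by
  rw [← Units.val_pow_eq_pow_val, ← zpow_natCast, coeff_expUnit_zpow]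
  simp

theorem derivative_expUnit : derivative ℚ (expUnit : ℚ⟦X⟧) = expUnit := by
  exact derivative_exp ℚ

theorem derivative_expUnit_inv :
    derivative ℚ ((expUnit⁻¹ : ℚ⟦X⟧ˣ) : ℚ⟦X⟧) = -((expUnit⁻¹ : ℚ⟦X⟧ˣ) : ℚ⟦X⟧) := by
  rw [derivative_inv, derivative_expUnit, pow_two, neg_mul, mul_assoc, Units.inv_mul, mul_one]

/-- The `j`-th Taylor coefficient of the `n`-th coefficient of the crank generating function. -/
noncomputable def crankCoeff (N n j : ℕ) : ℚ :=
  coeff j (coeff n (crankSeries (expUnit : ℚ⟦X⟧) ((expUnit⁻¹ : ℚ⟦X⟧ˣ) : ℚ⟦X⟧) N))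

theorem sum_crank_pow {n : ℕ} (hn : 2 ≤ n) (j : ℕ) :
    ∑ lam : n.Partition, (crank lam : ℚ) ^ j = j.factorial * crankCoeff n n j := by
  rw [crankCoeff, ← sum_zpow_crank_eq_coeff_crankSeries expUnit hn le_rfl, map_sum, mul_sum]
  refine sum_congr rfl fun lam _ => ?_
  rw [coeff_expUnit_zpow, mul_div_cancel₀]
  exact_mod_cast j.factorial_ne_zero

theorem crankCoeff_zero {n N : ℕ} (hnN : n ≤ N) : crankCoeff N n 0 = partitionCount n := by
  have hgeom (w : ℚ⟦X⟧) (hw : constantCoeff w = 1) (i : ℕ) :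
      PowerSeries.map constantCoeff (geomSeries w i) = geomSeries (1 : ℚ) i := by
    ext m
    simp only [geomSeries, coeff_map, coeff_mk]
    split_ifs <;> simp [hw]
  have hexp : constantCoeff (expUnit : ℚ⟦X⟧) = 1 := constantCoeff_exp
  have hinv : constantCoeff ((expUnit⁻¹ : ℚ⟦X⟧ˣ) : ℚ⟦X⟧) = 1 := by
    have h := congrArg constantCoeff (Units.mul_inv expUnit)
    rwa [map_mul, hexp, one_mul, map_one] at h
  have hmap : PowerSeries.map constantCoeff
      (crankSeries (expUnit : ℚ⟦X⟧) ((expUnit⁻¹ : ℚ⟦X⟧ˣ) : ℚ⟦X⟧) N) =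
        (1 - X ^ (N + 1)) * partSeries (R := ℚ) N := by
    rw [crankSeries, prod_Icc_succ_top (by omega)]
    simp only [map_mul, map_prod, map_sub, map_one, map_pow, map_X, hgeom _ hexp, hgeom _ hinv]
    rw [← qPoch_X, ← partSeries]
    linear_combination ((1 - X ^ (N + 1)) * partSeries (R := ℚ) N) *
      qPoch_X_mul_partSeries (R := ℚ) N
  rw [crankCoeff, coeff_zero_eq_constantCoeff_apply, ← coeff_map, hmap, sub_mul, one_mul, map_sub,
    coeff_X_pow_mul', if_neg (by omega), sub_zero, partSeries, coeff_prod_geomSeries_one hnN]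

theorem crankCoeff_succ {n N : ℕ} (hnN : n ≤ N) (j : ℕ) :
    (j + 1) * crankCoeff N n (j + 1) = ∑ p ∈ antidiagonal n, ∑ q ∈ antidiagonal j,
      crankCoeff N p.1 q.1 *
        (if Odd q.2 then 2 / (q.2.factorial : ℚ) * sigmaPow q.2 p.2 else 0) := by
  have h := congrArg (fun F => coeff j (coeff n F))
    (coeffDerivation_crankSeries (derivative ℚ) derivative_expUnit derivative_expUnit_inv N)
  simp only [coeff_coeffDerivation, coeff_derivative, coeff_mul, map_sum (coeff j)] at h
  rw [crankCoeff, mul_comm, h]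
  refine sum_congr rfl fun p hp => sum_congr rfl fun q _ => ?_
  have hpN : p.2 ≤ N := by have := mem_antidiagonal.mp hp; omega
  rw [← crankCoeff]
  congr 1
  rw [sum_sub_distrib, map_sub, coeff_sum_C_mul_X_pow_mul_geomSeries _ hpN,
    coeff_sum_C_mul_X_pow_mul_geomSeries _ hpN, map_sub, map_sum, map_sum]
  simp only [coeff_expUnit_pow, coeff_expUnit_inv_pow]
  split_ifs with hodd
  · rw [sigmaPow, Nat.cast_sum, mul_sum, ← sum_sub_distrib]
    refine sum_congr rfl fun m _ => ?_
    rw [hodd.neg_pow]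
    push_cast
    ring
  · simp [(Nat.not_odd_iff_even.mp hodd).neg_pow]

end Moments
section Exponential

variable {A : Type*} [CommRing A] [Algebra ℚ A]

/-- The composition `exp y`, for a power series `y` without constant term. -/
noncomputable def expComp (y : A⟦X⟧) : A⟦X⟧ :=
  PowerSeries.mk fun j => ∑ k ∈ range (j + 1), (1 / (k.factorial : ℚ)) • coeff j (y ^ k)

theorem coeff_expComp {y : A⟦X⟧} (hy : constantCoeff y = 0) {j K : ℕ} (hK : j < K) :
    coeff j (expComp y) = ∑ k ∈ range K, (1 / (k.factorial : ℚ)) • coeff j (y ^ k) := by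
  rw [expComp, coeff_mk]
  refine sum_subset (range_subset_range.mpr hK) fun k _ hk => ?_
  rw [X_pow_dvd_iff.mp (pow_dvd_pow_of_dvd (X_dvd_iff.mpr hy) k) j (by simpa using hk), smul_zero]

theorem derivative_expComp {y : A⟦X⟧} (hy : constantCoeff y = 0) :
    derivative A (expComp y) = expComp y * derivative A y := by
  ext j
  have h1 : coeff j (expComp y * derivative A y) =
      ∑ k ∈ range (j + 1), (1 / (k.factorial : ℚ)) • coeff j (y ^ k * derivative A y) := by
    simp only [coeff_mul, smul_sum]
    rw [sum_comm]
    refine sum_congr rfl fun p hp => ?_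
    have := mem_antidiagonal.mp hp
    rw [coeff_expComp hy (by omega : p.1 < j + 1), sum_mul]
    simp only [smul_mul_assoc]
  rw [h1, coeff_derivative, coeff_expComp hy (Nat.lt_succ_self _), sum_mul, sum_range_succ']
  simp only [pow_zero, coeff_one, Nat.add_eq_zero_iff, one_ne_zero, and_false, if_false, smul_zero,
    zero_mul, add_zero]
  refine sum_congr rfl fun k _ => ?_
  rw [smul_mul_assoc]
  have h2 := congrArg (coeff j) (derivative_pow y (k + 1))
  rw [coeff_derivative] at h2
  push_cast at h2
  rw [h2]
  have h3 : ((k + 1 : A⟦X⟧)) * y ^ k * derivative A y =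
      ((k + 1 : ℕ) : ℚ) • (y ^ k * derivative A y) := by
    rw [Nat.cast_smul_eq_nsmul, nsmul_eq_mul]
    push_cast
    ring
  rw [h3, coeff_smul, smul_smul]
  congr 1
  rw [Nat.factorial_succ]
  have : (k.factorial : ℚ) ≠ 0 := by exact_mod_cast k.factorial_ne_zero
  push_cast
  field_simp

theorem derivative_C_mul_expComp (P : A) {y : A⟦X⟧} (hy : constantCoeff y = 0) :
    derivative A (C P * expComp y) = C P * expComp y * derivative A y := by
  rw [Derivation.leibniz, derivative_C, smul_zero, add_zero, smul_eq_mul, derivative_expComp hy,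
    mul_assoc]

end Exponential

section Moments

/-- The generating function of the divisor power sums `σ_k`. -/
def sigmaSeries (k : ℕ) : ℚ⟦X⟧ := PowerSeries.mk fun n => (sigmaPow k n : ℚ)

/-- The exponent of the crank moment generating function, as a series in the square of the
moment variable. -/
noncomputable def halfExponent : ℚ⟦X⟧⟦X⟧ :=
  PowerSeries.mk fun i => if i = 0 then 0 else
    C (2 / ((2 * i).factorial : ℚ)) * sigmaSeries (2 * i - 1)

/-- The generating function of the crank moments, in exponential form. -/
noncomputable def momentSeries : ℚ⟦X⟧⟦X⟧ :=
  C (PowerSeries.mk fun n => (partitionCount n : ℚ)) *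
    expComp (PowerSeries.expand 2 two_ne_zero halfExponent)

theorem constantCoeff_halfExponent : constantCoeff halfExponent = 0 := by
  rw [← coeff_zero_eq_constantCoeff_apply, halfExponent, coeff_mk, if_pos rfl]

theorem coeff_halfExponent {i : ℕ} (hi : i ≠ 0) :
    coeff i halfExponent = C (2 / ((2 * i).factorial : ℚ)) * sigmaSeries (2 * i - 1) := by
  rw [halfExponent, coeff_mk, if_neg hi]

theorem constantCoeff_expand_halfExponent :
    constantCoeff (PowerSeries.expand 2 two_ne_zero halfExponent) = 0 := by
  rw [constantCoeff_expand, constantCoeff_halfExponent]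

theorem coeff_derivative_expand_halfExponent (j n : ℕ) :
    coeff n (coeff j (derivative ℚ⟦X⟧ (PowerSeries.expand 2 two_ne_zero halfExponent))) =
      if Odd j then 2 / (j.factorial : ℚ) * sigmaPow j n else 0 := by
  rw [coeff_derivative]
  split_ifs with h
  · obtain ⟨i, rfl⟩ := h
    have hf : ((2 * i + 1).factorial : ℚ) ≠ 0 := by exact_mod_cast Nat.factorial_ne_zero _
    have hc : (((2 * i + 1 : ℕ) : ℚ⟦X⟧) + 1) = C ((2 * i + 1 + 1 : ℕ) : ℚ) := by
      rw [map_natCast]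
      push_cast
      rfl
    rw [show 2 * i + 1 + 1 = 2 * (i + 1) by ring, coeff_expand_mul,
      coeff_halfExponent (Nat.succ_ne_zero i), hc, mul_comm, coeff_C_mul, coeff_C_mul, sigmaSeries,
      coeff_mk, show 2 * (i + 1) = 2 * i + 1 + 1 by ring, Nat.factorial_succ, Nat.add_sub_cancel]
    push_cast
    field_simp
  · rw [coeff_expand_of_not_dvd]
    · simp
    · rw [← even_iff_two_dvd]
      grind

theorem momentSeries_succ (n j : ℕ) :
    (j + 1) * coeff n (coeff (j + 1) momentSeries) = ∑ p ∈ antidiagonal n, ∑ q ∈ antidiagonal j,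
      coeff p.1 (coeff q.1 momentSeries) *
        (if Odd q.2 then 2 / (q.2.factorial : ℚ) * sigmaPow q.2 p.2 else 0) := by
  have h : derivative ℚ⟦X⟧ momentSeries = momentSeries *
      derivative ℚ⟦X⟧ (PowerSeries.expand 2 two_ne_zero halfExponent) := by
    exact derivative_C_mul_expComp _ constantCoeff_expand_halfExponent
  have h := congrArg (fun F => coeff n (coeff j F)) h
  simp only [coeff_derivative (R := ℚ⟦X⟧) momentSeries, coeff_mul j, map_sum] at h
  simp only [coeff_mul n, coeff_derivative_expand_halfExponent] at h
  rw [sum_comm, ← h]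
  have hc : ((j : ℚ⟦X⟧) + 1) = C ((j : ℚ) + 1) := by simp
  rw [hc, ← coeff_mul, mul_comm (coeff _ momentSeries), coeff_C_mul]

theorem crankCoeff_eq_coeff_momentSeries {N : ℕ} (j : ℕ) {n : ℕ} (hnN : n ≤ N) :
    crankCoeff N n j = coeff n (coeff j momentSeries) := by
  induction j using Nat.strong_induction_on generalizing n with
  | _ j ih =>
    cases j with
    | zero =>
      rw [crankCoeff_zero hnN, momentSeries, coeff_C_mul, expComp]
      simp
    | succ j =>
      have hj : (j + 1 : ℚ) ≠ 0 := by positivity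
      refine mul_left_cancel₀ hj ?_
      rw [crankCoeff_succ hnN, momentSeries_succ]
      refine sum_congr rfl fun p hp => sum_congr rfl fun q hq => ?_
      have := mem_antidiagonal.mp hp
      have := mem_antidiagonal.mp hq
      rw [ih q.1 (by omega) (by omega)]

theorem coeff_prod_fin {R : Type*} [CommRing R] {k : ℕ} (f : Fin k → R⟦X⟧) (n : ℕ) :
    coeff n (∏ j, f j) = ∑ t ∈ piAntidiag univ n, ∏ j, coeff (t j) (f j) := by
  rw [PowerSeries.coeff_prod]
  refine sum_bij' (fun l _ => ⇑l) (fun t _ => Finsupp.equivFunOnFinite.symm t) ?_ ?_ ?_ ?_ ?_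
  · intro l hl
    simpa using (mem_finsuppAntidiag.mp hl).1
  · intro t ht
    simpa [mem_finsuppAntidiag] using ht
  · intro l _
    ext
    simp
  · intro t _
    ext
    simp
  · intro l _
    rfl

theorem coeff_prod_fin_of_constantCoeff_eq_zero {R : Type*} [CommRing R] {k : ℕ}
    {f : Fin k → R⟦X⟧} (hf : ∀ j, constantCoeff (f j) = 0) (n : ℕ) :
    coeff n (∏ j, f j) = ∑ t ∈ (Fintype.piFinset fun _ : Fin k => Icc 1 n).filter
      (fun t => ∑ j, t j = n), ∏ j, coeff (t j) (f j) := by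
  rw [coeff_prod_fin]
  symm
  refine sum_subset (fun t ht => by simpa using (mem_filter.mp ht).2) fun t ht ht' => ?_
  have ht : ∑ j, t j = n := by simpa using ht
  obtain ⟨j, hj⟩ : ∃ j, t j = 0 := by
    by_contra! hcon
    refine ht' (mem_filter.mpr ⟨Fintype.mem_piFinset.mpr fun j => mem_Icc.mpr ⟨?_, ?_⟩, ht⟩)
    · exact Nat.pos_of_ne_zero (hcon j)
    · exact ht ▸ single_le_sum (fun i _ => Nat.zero_le _) (mem_univ j)
  exact prod_eq_zero (mem_univ j) (by rw [hj, coeff_zero_eq_constantCoeff_apply, hf])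

theorem constantCoeff_sigmaSeries (k : ℕ) : constantCoeff (sigmaSeries k) = 0 := by
  rw [← coeff_zero_eq_constantCoeff_apply, sigmaSeries, coeff_mk, sigmaPow, Nat.divisors_zero,
    sum_empty, Nat.cast_zero]

theorem coeff_mk_partitionCount_mul_prod {k : ℕ} (hk : 1 ≤ k) (s : Fin k → ℕ) (n : ℕ) :
    coeff n (PowerSeries.mk (fun m => (partitionCount m : ℚ)) * ∏ j, sigmaSeries (s j)) =
      ∑ t ∈ ((Finset.range n ×ˢ Fintype.piFinset fun _ : Fin k => Finset.Icc 1 n).filter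
          (fun t => t.1 + ∑ j, t.2 j = n)),
        (partitionCount t.1 : ℚ) * ∏ j, (sigmaPow (s j) (t.2 j) : ℚ) := by
  simp only [coeff_mul, coeff_mk, mul_sum,
    coeff_prod_fin_of_constantCoeff_eq_zero fun j => constantCoeff_sigmaSeries (s j)]
  rw [sum_sigma']
  refine sum_bij' (fun x _ => (x.1.1, x.2)) (fun t _ => ⟨(t.1, ∑ j, t.2 j), t.2⟩) ?_ ?_ ?_ ?_ ?_
  · rintro ⟨⟨m, l⟩, t⟩ hx
    simp only [mem_sigma, HasAntidiagonal.mem_antidiagonal, mem_filter,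
      Fintype.mem_piFinset, mem_Icc] at hx
    obtain ⟨hml, ht, hs⟩ := hx
    have := ht ⟨0, hk⟩
    simp only [mem_filter, mem_product, mem_range, Fintype.mem_piFinset, mem_Icc]
    exact ⟨⟨by omega, fun j => ⟨(ht j).1, by have := ht j; omega⟩⟩, by omega⟩
  · rintro ⟨m, t⟩ hx
    simp only [mem_filter, mem_product, mem_range, Fintype.mem_piFinset, mem_Icc] at hx
    simp only [mem_sigma, HasAntidiagonal.mem_antidiagonal, mem_filter,
      Fintype.mem_piFinset, mem_Icc, and_true]
    exact ⟨hx.2, fun j => ⟨(hx.1.2 j).1, single_le_sum (f := t) (fun _ _ => Nat.zero_le _)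
      (mem_univ j)⟩⟩
  · rintro ⟨⟨m, l⟩, t⟩ hx
    simp only [mem_sigma, mem_filter] at hx
    simp [hx.2.2]
  · intros
    rfl
  · intros
    simp [sigmaSeries]

end Moments

theorem crank_moment_formula (a n : ℕ) (ha : 1 ≤ a) (hn : 2 ≤ n) :
    ∑ lam : Nat.Partition n, (crank lam : ℚ) ^ (2 * a)
      = ∑ k ∈ Finset.Icc 1 a,
          ∑ i ∈ (Fintype.piFinset fun _ : Fin k => Finset.Icc 1 a).filter
              (fun i => ∑ j, i j = a),
            ((2 : ℚ) ^ k * ((2 * a).factorial : ℚ))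
                / ((k.factorial : ℚ) * ∏ j, ((2 * i j).factorial : ℚ))
              * ∑ t ∈ ((Finset.range n ×ˢ
                    Fintype.piFinset fun _ : Fin k => Finset.Icc 1 n).filter
                  (fun t => t.1 + ∑ j, t.2 j = n)),
                  (partitionCount t.1 : ℚ) * ∏ j, (sigmaPow (2 * i j - 1) (t.2 j) : ℚ) := by
  have hfact (m : ℕ) : (m.factorial : ℚ) ≠ 0 := by exact_mod_cast m.factorial_ne_zero
  rw [sum_crank_pow hn, crankCoeff_eq_coeff_momentSeries _ le_rfl, momentSeries, coeff_C_mul,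
    coeff_expComp constantCoeff_expand_halfExponent (Nat.lt_succ_self _), mul_sum, map_sum, mul_sum]
  symm
  refine sum_subset_zero_on_sdiff (fun k hk => ?_) (fun k hk => ?_) (fun k hk => ?_)
  · grind
  · rw [← map_pow, coeff_expand_mul]
    have : coeff a (halfExponent ^ k) = 0 := by
      obtain rfl | hk0 := Nat.eq_zero_or_pos k
      · rw [pow_zero, coeff_one, if_neg (by omega)]
      · exact X_pow_dvd_iff.mp (pow_dvd_pow_of_dvd (X_dvd_iff.mpr constantCoeff_halfExponent) k) a
          (by grind)
    simp [this]
  · have hpow : halfExponent ^ k = ∏ _j : Fin k, halfExponent := by simp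
    rw [← map_pow, coeff_expand_mul, hpow,
      coeff_prod_fin_of_constantCoeff_eq_zero (fun _ => constantCoeff_halfExponent), smul_sum,
      mul_sum, map_sum, mul_sum]
    refine sum_congr rfl fun i hi => ?_
    have hi0 (j : Fin k) : i j ≠ 0 := by
      have := Fintype.mem_piFinset.mp (mem_filter.mp hi).1 j
      grind
    rw [← coeff_mk_partitionCount_mul_prod (mem_Icc.mp hk).1]
    simp only [coeff_halfExponent (hi0 _)]
    rw [prod_mul_distrib, ← map_prod, mul_smul_comm, coeff_smul, mul_left_comm, coeff_C_mul,
      prod_div_distrib, prod_const, card_univ, Fintype.card_fin, smul_eq_mul]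
    have := prod_ne_zero_iff.mpr fun j (_ : j ∈ univ) => hfact (2 * i j)
    have := hfact k
    field_simp
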